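/- Let m = 4 and consider the two real skew-symmetric matrices A₁ with entries a₁₂ = a₁₃ = a₁₄ = a₂₃ = a₂₄ = a₃₄ = 1 (above the diagonal) and A₂ with entries a₁₂ = 1/2, a₁₃ = 1, a₁₄ = 1/2, a₂₃ = 1/2, a₂₄ = 1, a₃₄ = 1/2 (above the diagonal). Then A₁ and A₂ are transversal, for every proper nonempty subset α ⊊ {1,2,3,4} the restrictions of V_{A₁} and V_{A₂} to the face Γ_α are homotopic (as Volterra operators on S^{|α|−1}), but V_{A₁} and V_{A₂} are not homotopic on the whole simplex S³. -/

import Mathlib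

open Matrix

/-- A matrix defining a Volterra quadratic stochastic operator:
skew-symmetric with entries of absolute value at most 1. -/
def IsQSOMatrix {n : Type*} [Fintype n] (A : Matrix n n ℝ) : Prop :=
  Aᵀ = -A ∧ ∀ i j, |A i j| ≤ 1

/-- The Volterra quadratic stochastic operator associated to a matrix `A`:
`(V_A x)_k = x_k (1 + ∑ i, a_{k i} x_i)`. -/
noncomputable def volterra {n : Type*} [Fintype n] (A : Matrix n n ℝ) (x : n → ℝ) : n → ℝ :=
  fun k => x k * (1 + ∑ i, A k i * x i)

/-- The set of fixed points of `V_A` in the standard simplex. -/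
def FixSet {n : Type*} [Fintype n] (A : Matrix n n ℝ) : Set (n → ℝ) :=
  {x ∈ stdSimplex ℝ n | volterra A x = x}

/-- A skew-symmetric matrix is transversal if every principal submatrix on an
evenly-sized index set has nonzero determinant. -/
def IsTransversal {n : Type*} [Fintype n] [DecidableEq n] (A : Matrix n n ℝ) : Prop :=
  ∀ s : Finset n, Even s.card →
    (A.submatrix (fun i : s => (i : n)) (fun i : s => (i : n))).det ≠ 0

/-- Two (transversal) Volterra operators are homotopic if they are joined by a
continuous family of transversal Volterra matrices along which the number of
fixed points is constant. -/
def QSOHomotopic {n : Type*} [Fintype n] [DecidableEq n] (A₀ A₁ : Matrix n n ℝ) : Prop :=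
  ∃ A : ℝ → Matrix n n ℝ,
    ContinuousOn A (Set.Icc 0 1) ∧
    A 0 = A₀ ∧ A 1 = A₁ ∧
    (∀ t ∈ Set.Icc (0:ℝ) 1, IsQSOMatrix (A t) ∧ IsTransversal (A t)) ∧
    (∀ t ∈ Set.Icc (0:ℝ) 1, (FixSet (A t)).ncard = (FixSet A₀).ncard) ∧
    (FixSet A₀).ncard = (FixSet A₁).ncard
/-- The principal submatrix of `A` on the index set `α`, corresponding to the
restriction of the Volterra operator `V_A` to the face `Γ_α`. -/
def restrictM {m : ℕ} (A : Matrix (Fin m) (Fin m) ℝ) (α : Finset (Fin m)) :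
    Matrix α α ℝ :=
  A.submatrix (fun i => (i : Fin m)) (fun i => (i : Fin m))

/-- The first example matrix. -/
noncomputable def exA₁ : Matrix (Fin 4) (Fin 4) ℝ :=
  !![0, 1, 1, 1;
     -1, 0, 1, 1;
     -1, -1, 0, 1;
     -1, -1, -1, 0]

/-- The second example matrix. -/
noncomputable def exA₂ : Matrix (Fin 4) (Fin 4) ℝ :=
  !![0, 1/2, 1, 1/2;
     -(1/2), 0, 1/2, 1;
     -1, -(1/2), 0, 1/2;
     -(1/2), -1, -(1/2), 0]

/-- The Pfaffian of a skew-symmetric `4 × 4` matrix. -/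
def pfaffianFour (A : Matrix (Fin 4) (Fin 4) ℝ) : ℝ :=
  A 0 1 * A 2 3 - A 0 2 * A 1 3 + A 0 3 * A 1 2

lemma skew_apply {n : Type*} {A : Matrix n n ℝ} (hA : Aᵀ = -A) (i j : n) :
    A j i = -A i j := by
  simpa using congrFun (congrFun hA i) j

lemma skew_diag {n : Type*} {A : Matrix n n ℝ} (hA : Aᵀ = -A) (i : n) : A i i = 0 := by
  linarith [skew_apply hA i i]

lemma det_eq_pfaffianFour_sq {A : Matrix (Fin 4) (Fin 4) ℝ} (hA : Aᵀ = -A) :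
    A.det = pfaffianFour A ^ 2 := by
  have h (i : Fin 4) : A i i = 0 := skew_diag hA i
  rw [Matrix.det_succ_row_zero]
  simp [Fin.sum_univ_succ, Matrix.det_fin_three, Fin.succAbove, h, pfaffianFour,
    skew_apply hA 0 1, skew_apply hA 0 2, skew_apply hA 0 3, skew_apply hA 1 2,
    skew_apply hA 1 3, skew_apply hA 2 3]
  ring

lemma det_submatrix_univ {n : Type*} [Fintype n] [DecidableEq n] (A : Matrix n n ℝ) :
    (A.submatrix (fun i : (Finset.univ : Finset n) => (i : n))
      (fun i : (Finset.univ : Finset n) => (i : n))).det = A.det := by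
  let e : (Finset.univ : Finset n) ≃ n := Equiv.subtypeUnivEquiv fun i => Finset.mem_univ i
  rw [← Matrix.det_submatrix_equiv_self e A]
  congr 1

/-- Principal minors of order `0` and `2` of a skew-symmetric matrix with nonzero off-diagonal
entries do not vanish. -/
lemma det_submatrix_ne_zero_of_card_lt_four {n : Type*} [DecidableEq n] {A : Matrix n n ℝ}
    (hA : Aᵀ = -A) (hne : ∀ i j, i ≠ j → A i j ≠ 0) {s : Finset n} (hs : Even s.card)
    (hlt : s.card < 4) :
    (A.submatrix (fun i : s => (i : n)) (fun i : s => (i : n))).det ≠ 0 := by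
  obtain h | h : s.card = 0 ∨ s.card = 2 := by
    obtain ⟨k, hk⟩ := hs
    omega
  · obtain rfl := Finset.card_eq_zero.mp h
    simp
  · have e : Fin 2 ≃ s := (s.equivFinOfCardEq h).symm
    have h01 : ((e 0 : s) : n) ≠ e 1 := fun hc =>
      absurd (e.injective (Subtype.ext hc)) (by decide)
    rw [← Matrix.det_submatrix_equiv_self e, Matrix.det_fin_two]
    simp only [Matrix.submatrix_apply, skew_diag hA, skew_apply hA (e 0 : n) (e 1)]
    have := mul_self_pos.mpr (hne _ _ h01)
    intro hc
    linarith

lemma isTransversal_of_card_lt_four {n : Type*} [Fintype n] [DecidableEq n] {A : Matrix n n ℝ}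
    (hA : Aᵀ = -A) (hne : ∀ i j, i ≠ j → A i j ≠ 0) (hn : Fintype.card n < 4) :
    IsTransversal A := fun s hs =>
  det_submatrix_ne_zero_of_card_lt_four hA hne hs ((Finset.card_le_univ s).trans_lt hn)

lemma isTransversal_of_pfaffianFour_ne_zero {A : Matrix (Fin 4) (Fin 4) ℝ}
    (hA : Aᵀ = -A) (hne : ∀ i j, i ≠ j → A i j ≠ 0) (hpf : pfaffianFour A ≠ 0) :
    IsTransversal A := by
  intro s hs
  by_cases hu : s = Finset.univ
  · subst hu
    rw [det_submatrix_univ, det_eq_pfaffianFour_sq hA]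
    exact pow_ne_zero 2 hpf
  · refine det_submatrix_ne_zero_of_card_lt_four hA hne hs ?_
    simpa using Finset.card_lt_card (Finset.ssubset_univ_iff.mpr hu)

lemma ne_zero_of_pos_above {n : Type*} [LinearOrder n] {A : Matrix n n ℝ} (hA : Aᵀ = -A)
    (hpos : ∀ i j, i < j → 0 < A i j) (i j : n) (hij : i ≠ j) : A i j ≠ 0 := by
  rcases lt_or_gt_of_ne hij with h | h
  · exact (hpos i j h).ne'
  · rw [skew_apply hA j i]
    exact (neg_neg_of_pos (hpos j i h)).ne

/-- If all entries above the diagonal are positive, the only fixed points are the vertices. -/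
lemma fixSet_eq_range_single {n : Type*} [Fintype n] [LinearOrder n] {A : Matrix n n ℝ}
    (hA : Aᵀ = -A) (hpos : ∀ i j, i < j → 0 < A i j) :
    FixSet A = Set.range fun i : n => (Pi.single i 1 : n → ℝ) := by
  ext x
  constructor
  · rintro ⟨⟨hx0, hx1⟩, hfix⟩
    have hex : (Finset.univ.filter fun i => x i ≠ 0).Nonempty := by
      by_contra hempty
      rw [Finset.not_nonempty_iff_eq_empty, Finset.filter_eq_empty_iff] at hempty
      have : ∑ i, x i = 0 := Finset.sum_eq_zero fun i hi => not_not.mp (hempty hi)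
      linarith
    obtain ⟨i, hi, hmin⟩ := Finset.exists_min_image _ id hex
    have hxi : x i ≠ 0 := (Finset.mem_filter.mp hi).2
    have hbelow : ∀ j, j < i → x j = 0 := fun j hj => by
      by_contra hxj
      exact absurd (hmin j (by simp [hxj])) (not_le.mpr hj)
    have hsum : ∑ j, A i j * x j = 0 := by
      have h := congrFun hfix i
      simp only [volterra] at h
      have : x i * ∑ j, A i j * x j = 0 := by linarith
      exact (mul_eq_zero.mp this).resolve_left hxi
    have hterm : ∀ j ∈ Finset.univ, 0 ≤ A i j * x j := fun j _ => by
      rcases lt_trichotomy j i with h | rfl | h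
      · simp [hbelow j h]
      · simp [skew_diag hA]
      · exact mul_nonneg (hpos i j h).le (hx0 j)
    have hzero : ∀ j, j ≠ i → x j = 0 := fun j hj => by
      rcases lt_or_gt_of_ne hj with h | h
      · exact hbelow j h
      · exact (mul_eq_zero.mp ((Finset.sum_eq_zero_iff_of_nonneg hterm).mp hsum j
          (Finset.mem_univ j))).resolve_left (hpos i j h).ne'
    have hone : x i = 1 := by
      rw [← hx1, Finset.sum_eq_single i (fun j _ hj => hzero j hj) (by simp)]
    refine ⟨i, funext fun j => ?_⟩
    by_cases hj : j = i
    · subst hj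
      simp [hone]
    · simp [hj, hzero j hj]
  · rintro ⟨i, rfl⟩
    refine ⟨single_mem_stdSimplex ℝ i, funext fun j => ?_⟩
    by_cases hj : j = i
    · subst hj
      simp [volterra, Pi.single_apply, skew_diag hA]
    · simp [volterra, hj]

lemma ncard_fixSet {n : Type*} [Fintype n] [LinearOrder n] {A : Matrix n n ℝ}
    (hA : Aᵀ = -A) (hpos : ∀ i j, i < j → 0 < A i j) :
    (FixSet A).ncard = Fintype.card n := by
  have hinj : Function.Injective fun i : n => (Pi.single i 1 : n → ℝ) := fun i j hij => by
    by_contra hne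
    simpa [hne] using congrFun hij i
  rw [fixSet_eq_range_single hA hpos, ← Set.image_univ,
    Set.ncard_image_of_injective _ hinj,
    Set.ncard_univ, Nat.card_eq_fintype_card]

/-- In fewer than four dimensions, the segment between two Volterra matrices that are positive
above the diagonal is a homotopy. -/
lemma qsoHomotopic_of_pos_above {n : Type*} [Fintype n] [LinearOrder n] {A B : Matrix n n ℝ}
    (hA : IsQSOMatrix A) (hB : IsQSOMatrix B) (hApos : ∀ i j, i < j → 0 < A i j)
    (hBpos : ∀ i j, i < j → 0 < B i j) (hn : Fintype.card n < 4) :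
    QSOHomotopic A B := by
  have hskew (t : ℝ) : ((1 - t) • A + t • B)ᵀ = -((1 - t) • A + t • B) := by
    rw [Matrix.transpose_add, Matrix.transpose_smul, Matrix.transpose_smul, hA.1, hB.1]
    module
  have hpos : ∀ t ∈ Set.Icc (0 : ℝ) 1, ∀ i j, i < j → 0 < ((1 - t) • A + t • B) i j := by
    rintro t ⟨ht0, ht1⟩ i j hij
    exact (convex_Ioi (0 : ℝ)) (hApos i j hij) (hBpos i j hij) (sub_nonneg.mpr ht1) ht0
      (sub_add_cancel 1 t)
  refine ⟨fun t => (1 - t) • A + t • B, by fun_prop, by simp, by simp, fun t ht => ⟨⟨hskew t, ?_⟩,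
    isTransversal_of_card_lt_four (hskew t) (ne_zero_of_pos_above (hskew t) (hpos t ht)) hn⟩,
    fun t ht => ?_, ?_⟩
  · intro i j
    exact abs_le.mpr ((convex_Icc (-1 : ℝ) 1) (abs_le.mp (hA.2 i j)) (abs_le.mp (hB.2 i j))
      (sub_nonneg.mpr ht.2) ht.1 (sub_add_cancel 1 t))
  · rw [ncard_fixSet (hskew t) (hpos t ht), ncard_fixSet hA.1 hApos]
  · rw [ncard_fixSet hA.1 hApos, ncard_fixSet hB.1 hBpos]

/-- The sign of the Pfaffian is a homotopy invariant. -/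
lemma not_qsoHomotopic_of_pfaffianFour {A B : Matrix (Fin 4) (Fin 4) ℝ}
    (hA : 0 < pfaffianFour A) (hB : pfaffianFour B < 0) : ¬ QSOHomotopic A B := by
  rintro ⟨C, hC, rfl, rfl, hCt, -, -⟩
  have hentry (i j : Fin 4) : ContinuousOn (fun t => C t i j) (Set.Icc 0 1) :=
    (continuous_apply_apply i j).comp_continuousOn hC
  have hcont : ContinuousOn (fun t => pfaffianFour (C t)) (Set.Icc 0 1) :=
    (((hentry 0 1).mul (hentry 2 3)).sub ((hentry 0 2).mul (hentry 1 3))).add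
      ((hentry 0 3).mul (hentry 1 2))
  obtain ⟨t, ht, hzero⟩ := intermediate_value_Icc' zero_le_one hcont ⟨hB.le, hA.le⟩
  obtain ⟨⟨hskew, -⟩, htrans⟩ := hCt t ht
  refine htrans Finset.univ (by simp; decide) ?_
  rw [det_submatrix_univ, det_eq_pfaffianFour_sq hskew]
  simp only at hzero
  simp [hzero]

lemma isQSOMatrix_exA₁ : IsQSOMatrix exA₁ := by
  refine ⟨?_, fun i j => ?_⟩
  · ext i j
    fin_cases i <;> fin_cases j <;> simp [exA₁]
  · fin_cases i <;> fin_cases j <;> simp [exA₁]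

lemma isQSOMatrix_exA₂ : IsQSOMatrix exA₂ := by
  refine ⟨?_, fun i j => ?_⟩
  · ext i j
    fin_cases i <;> fin_cases j <;> simp [exA₂]
  · fin_cases i <;> fin_cases j <;> norm_num [exA₂, abs_le]

lemma exA₁_pos_above (i j : Fin 4) (hij : i < j) : 0 < exA₁ i j := by
  fin_cases i <;> fin_cases j <;> simp [exA₁] at hij ⊢

lemma exA₂_pos_above (i j : Fin 4) (hij : i < j) : 0 < exA₂ i j := by
  fin_cases i <;> fin_cases j <;> simp [exA₂] at hij ⊢

lemma pfaffianFour_exA₁ : pfaffianFour exA₁ = 1 := by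
  simp [pfaffianFour, exA₁]

lemma pfaffianFour_exA₂ : pfaffianFour exA₂ = -(1 / 2) := by
  simp [pfaffianFour, exA₂]
  norm_num

lemma IsQSOMatrix.restrictM {m : ℕ} {A : Matrix (Fin m) (Fin m) ℝ} (hA : IsQSOMatrix A)
    (α : Finset (Fin m)) : IsQSOMatrix (restrictM A α) :=
  ⟨by ext i j; exact skew_apply hA.1 (i : Fin m) j, fun i j => hA.2 i j⟩

theorem homotopic_on_all_proper_faces_not_on_simplex :
    IsTransversal exA₁ ∧ IsTransversal exA₂ ∧
    (∀ α : Finset (Fin 4), α.Nonempty → α ≠ Finset.univ →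
      QSOHomotopic (restrictM exA₁ α) (restrictM exA₂ α)) ∧
    ¬ QSOHomotopic exA₁ exA₂ := by
  refine ⟨?_, ?_, fun α _ hα => ?_, ?_⟩
  · exact isTransversal_of_pfaffianFour_ne_zero isQSOMatrix_exA₁.1
      (ne_zero_of_pos_above isQSOMatrix_exA₁.1 exA₁_pos_above) (by norm_num [pfaffianFour_exA₁])
  · exact isTransversal_of_pfaffianFour_ne_zero isQSOMatrix_exA₂.1
      (ne_zero_of_pos_above isQSOMatrix_exA₂.1 exA₂_pos_above) (by norm_num [pfaffianFour_exA₂])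
  · have hcard : Fintype.card α < 4 := by
      simpa using Finset.card_lt_card (Finset.ssubset_univ_iff.mpr hα)
    convert qsoHomotopic_of_pos_above (isQSOMatrix_exA₁.restrictM α) (isQSOMatrix_exA₂.restrictM α)
      (fun i j hij => exA₁_pos_above i j hij) (fun i j hij => exA₂_pos_above i j hij) hcard
  · exact not_qsoHomotopic_of_pfaffianFour (by norm_num [pfaffianFour_exA₁])
      (by norm_num [pfaffianFour_exA₂])
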